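/- arXiv:1206.3626 — 3 statements merged into one kernel-verified Lean document; each statement's English description precedes it below -/
import Mathlib

section
/- Let X and Y be connected graphs with their simplicial metrics, and assume X is δ_0-Gromov-hyperbolic. Let f : X → Y be an L-Lipschitz graph-map with f(V(X)) = V(Y). Suppose there are integers M_1 > 0 and M_2 > 0 such that for all vertices x, y of X, if d_Y(f(x), f(y)) ≤ M_1 then the diam_Y of f([x,y]) is at most M_2 for every geodesic [x,y] in X. Then there exists δ_1 > 0, depending only on δ_0, L, M_1, M_2, such that Y is δ_1-hyperbolic; moreover there exists H > 0 such that for any vertices x, y of X, the path f([x,y]) is H-Hausdorff-close to any geodesic from f(x) to f(y) in Y. -/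
/-!
STATEMENT 8: Let `X`, `Y` be connected graphs with `X` `δ₀`-hyperbolic, and let
`f : X → Y` be an `L`-Lipschitz graph-map with `f(V(X)) = V(Y)`. If there are integers
`M₁, M₂ > 0` such that `d_Y(f x, f y) ≤ M₁` implies `diam_Y f([x,y]) ≤ M₂`, then `Y`
is `δ₁`-hyperbolic for some `δ₁ > 0` depending only on `δ₀, L, M₁, M₂`, and moreover
there is `H > 0` such that `f([x,y])` is `H`-Hausdorff-close to any geodesic from
`f x` to `f y` in `Y`.
-/

universe u v

section GraphHyperbolicity

variable {V : Type*} {W : Type*}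

/-- The set of vertices visited by a walk. -/
def walkSet {G : SimpleGraph V} {a b : V} (p : G.Walk a b) : Set V :=
  {v | v ∈ p.support}

/-- A walk is geodesic if its length realizes the graph distance between its endpoints. -/
def IsGeodesicWalk (G : SimpleGraph V) {a b : V} (p : G.Walk a b) : Prop :=
  p.length = G.dist a b

/-- `s` is contained in the `δ`-neighborhood of `t` (with respect to the graph metric). -/
def WithinNbhd (G : SimpleGraph V) (δ : ℝ) (s t : Set V) : Prop :=
  ∀ x ∈ s, ∃ y ∈ t, (G.dist x y : ℝ) ≤ δ

/-- `s` and `t` are `H`-Hausdorff-close: each is contained in the `H`-neighborhood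
of the other. -/
def HausClose (G : SimpleGraph V) (H : ℝ) (s t : Set V) : Prop :=
  WithinNbhd G H s t ∧ WithinNbhd G H t s

/-- All geodesic triangles of `G` are `δ`-thin: each side lies in the `δ`-neighborhood
of the union of the other two sides. -/
def ThinTriangles (G : SimpleGraph V) (δ : ℝ) : Prop :=
  ∀ a b c : V, ∀ (p : G.Walk a b) (q : G.Walk b c) (r : G.Walk a c),
    IsGeodesicWalk G p → IsGeodesicWalk G q → IsGeodesicWalk G r →
      WithinNbhd G δ (walkSet p) (walkSet q ∪ walkSet r) ∧
      WithinNbhd G δ (walkSet q) (walkSet p ∪ walkSet r) ∧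
      WithinNbhd G δ (walkSet r) (walkSet p ∪ walkSet q)

/-- An `L`-Lipschitz graph-map `X → Y` (on vertices): each edge of `X` is sent to an
edge-path of `Y` of length at most `L`. -/
def IsLipschitzGraphMap (X : SimpleGraph V) (Y : SimpleGraph W) (L : ℕ)
    (f : V → W) : Prop :=
  ∀ a b : V, X.Adj a b → Y.Reachable (f a) (f b) ∧ Y.dist (f a) (f b) ≤ L

/-- The subset `s` has diameter at most `M` in the graph `Y`. -/
def SetDiamLE (Y : SimpleGraph W) (s : Set W) (M : ℝ) : Prop :=
  ∀ u ∈ s, ∀ v ∈ s, (Y.dist u v : ℝ) ≤ M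

end GraphHyperbolicity

namespace HypContr

open SimpleGraph

variable {V : Type*} {W : Type*}

lemma tri {G : SimpleGraph V} (hG : G.Preconnected) (a b c : V) :
    G.dist a c ≤ G.dist a b + G.dist b c :=
  (hG a b).dist_triangle_left c

/-- The vertex `m` lies on some geodesic from `x` to `y`. -/
def Btw (X : SimpleGraph V) (x y m : V) : Prop := X.dist x m + X.dist m y = X.dist x y

lemma subwalk {G : SimpleGraph V} {a b : V} (q : G.Walk a b) (i t : ℕ) :
    ∃ c : G.Walk (q.getVert i) (q.getVert (i + t)), c.length ≤ t ∧
      ∀ v ∈ c.support, v ∈ q.support := by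
  have e : (q.drop i).getVert t = q.getVert (i + t) := by simp
  refine ⟨((q.drop i).take t).copy rfl e, by simp, ?_⟩
  intro v hv
  rw [Walk.support_copy] at hv
  exact (((q.drop i).isSubwalk_take t).trans (q.isSubwalk_drop i)).support_subset hv

lemma dist_getVert_le {G : SimpleGraph V} {a b : V} (q : G.Walk a b) (i j : ℕ) (hij : i ≤ j) :
    G.dist (q.getVert i) (q.getVert j) ≤ j - i := by
  obtain ⟨t, rfl⟩ := Nat.exists_eq_add_of_le hij
  obtain ⟨c, hc, -⟩ := subwalk q i t
  have := dist_le c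
  omega

lemma dist_getVert {G : SimpleGraph V} (hG : G.Preconnected) {a b : V} (q : G.Walk a b)
    (hq : IsGeodesicWalk G q) (i j : ℕ) (hij : i ≤ j) (hj : j ≤ q.length) :
    G.dist (q.getVert i) (q.getVert j) = j - i := by
  have h1 := dist_getVert_le q i j hij
  have h2 := dist_getVert_le q 0 i (Nat.zero_le _)
  have h3 := dist_getVert_le q j q.length hj
  rw [Walk.getVert_zero] at h2
  rw [Walk.getVert_length] at h3
  have h4 := tri hG a (q.getVert i) b
  have h5 := tri hG (q.getVert i) (q.getVert j) b
  unfold IsGeodesicWalk at hq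
  omega

lemma btw_getVert {G : SimpleGraph V} (hG : G.Preconnected) {a b : V} (q : G.Walk a b)
    (hq : IsGeodesicWalk G q) (i k j : ℕ) (hik : i ≤ k) (hkj : k ≤ j) (hj : j ≤ q.length) :
    Btw G (q.getVert i) (q.getVert j) (q.getVert k) := by
  unfold Btw
  rw [dist_getVert hG q hq i k hik (by omega), dist_getVert hG q hq k j hkj hj,
    dist_getVert hG q hq i j (by omega) hj]
  omega

lemma btw_of_mem {G : SimpleGraph V} (hG : G.Preconnected) {a b m : V} (q : G.Walk a b)
    (hq : IsGeodesicWalk G q) (hm : m ∈ q.support) : Btw G a b m := by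
  obtain ⟨k, rfl, hk⟩ := Walk.mem_support_iff_exists_getVert.1 hm
  simpa using btw_getVert hG q hq 0 k q.length (Nat.zero_le _) hk le_rfl

lemma exists_geod {G : SimpleGraph V} (hG : G.Preconnected) (a b : V) :
    ∃ q : G.Walk a b, IsGeodesicWalk G q :=
  (hG a b).exists_walk_length_eq_dist

lemma mem_of_btw {G : SimpleGraph V} (hG : G.Preconnected) {a b m : V} (h : Btw G a b m) :
    ∃ q : G.Walk a b, IsGeodesicWalk G q ∧ m ∈ q.support := by
  obtain ⟨q, hq⟩ := exists_geod hG a m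
  obtain ⟨r, hr⟩ := exists_geod hG m b
  refine ⟨q.append r, ?_, ?_⟩
  · unfold IsGeodesicWalk at *
    unfold Btw at h
    rw [Walk.length_append, hq, hr, h]
  · rw [Walk.mem_support_append_iff]
    exact Or.inl q.end_mem_support

/-- Two points of a geodesic are joined by a geodesic inside it. -/
lemma exists_sub_geod {G : SimpleGraph V} (hG : G.Preconnected) {a b u v : V} (q : G.Walk a b)
    (hq : IsGeodesicWalk G q) (hu : u ∈ q.support) (hv : v ∈ q.support) :
    ∃ c : G.Walk u v, c.length ≤ G.dist u v ∧ ∀ z ∈ c.support, z ∈ q.support := by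
  obtain ⟨i, rfl, hi⟩ := Walk.mem_support_iff_exists_getVert.1 hu
  obtain ⟨j, rfl, hj⟩ := Walk.mem_support_iff_exists_getVert.1 hv
  rcases le_total i j with hij | hij
  · obtain ⟨t, rfl⟩ := Nat.exists_eq_add_of_le hij
    obtain ⟨c, hc, hs⟩ := subwalk q i t
    have := dist_getVert hG q hq i (i + t) hij hj
    exact ⟨c, by omega, hs⟩
  · obtain ⟨t, rfl⟩ := Nat.exists_eq_add_of_le hij
    obtain ⟨c, hc, hs⟩ := subwalk q j t
    have := dist_getVert hG q hq j (j + t) hij hi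
    refine ⟨c.reverse, ?_, ?_⟩
    · rw [Walk.length_reverse, SimpleGraph.dist_comm]
      omega
    · intro z hz
      rw [Walk.support_reverse, List.mem_reverse] at hz
      exact hs z hz

lemma lip {X : SimpleGraph V} {Y : SimpleGraph W} {L : ℕ} {f : V → W} (hX : X.Preconnected)
    (hY : Y.Preconnected) (hf : IsLipschitzGraphMap X Y L f) (a b : V) :
    Y.dist (f a) (f b) ≤ L * X.dist a b := by
  obtain ⟨p, hp⟩ := exists_geod hX a b
  unfold IsGeodesicWalk at hp
  rw [← hp]
  clear hp
  induction p with
  | nil => simp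
  | @cons u v w h p ih =>
    have h1 := (hf _ _ h).2
    have h2 := tri hY (f u) (f v) (f w)
    rw [Walk.length_cons, Nat.mul_add]
    omega

/-- The logarithmic estimate. -/
lemma log_lemma {X : SimpleGraph V} {Y : SimpleGraph W} {K M : ℕ} {f : V → W}
    (hY : Y.Preconnected) (hf : Function.Surjective f)
    (hthin : ∀ x y z m, Btw X x y m →
      ∃ m', (Btw X x z m' ∨ Btw X z y m') ∧ Y.dist (f m) (f m') ≤ K)
    (hdiam : ∀ x y m, Btw X x y m → Y.dist (f x) (f y) ≤ 1 → Y.dist (f m) (f x) ≤ M)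
    (N : ℕ) : ∀ (u v : W) (c : Y.Walk u v), c.length ≤ 2 ^ N → ∀ x y m : V, f x = u → f y = v →
      Btw X x y m → ∃ z ∈ c.support, Y.dist (f m) z ≤ K * N + M := by
  induction N with
  | zero =>
    rintro u v c hc x y m rfl rfl hm
    refine ⟨f x, c.start_mem_support, ?_⟩
    have := hdiam x y m hm ((dist_le c).trans (by simpa using hc))
    omega
  | succ N ih =>
    rintro u v c hc x y m hx hy hm
    obtain ⟨z, hz⟩ := hf (c.getVert (2 ^ N))
    obtain ⟨m', hm', hK⟩ := hthin x y z m hm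
    rw [pow_succ] at hc
    rcases hm' with hm' | hm'
    · obtain ⟨w, hw, hd⟩ := ih _ _ (c.take (2 ^ N)) (by simp) x z m' hx hz hm'
      refine ⟨w, (c.isSubwalk_take _).support_subset hw, ?_⟩
      have := tri hY (f m) (f m') w
      rw [Nat.mul_add]
      omega
    · obtain ⟨w, hw, hd⟩ := ih _ _ (c.drop (2 ^ N)) (by simp; omega) z y m' hz hy hm'
      refine ⟨w, (c.isSubwalk_drop _).support_subset hw, ?_⟩
      have := tri hY (f m) (f m') w
      rw [Nat.mul_add]
      omega

lemma exits (h : ℕ → ℕ) (L B : ℕ) (h0 : h 0 = 0) (hs : ∀ t, h (t + 1) ≤ h t + L) (T : ℕ) :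
    ∃ t ≤ T, (t = T ∨ B ≤ h t) ∧ h t ≤ B + L := by
  induction T with
  | zero => exact ⟨0, le_rfl, Or.inl rfl, by omega⟩
  | succ T ih =>
    obtain ⟨t, ht, h1, h2⟩ := ih
    by_cases hB : B ≤ h t
    · exact ⟨t, by omega, Or.inr hB, h2⟩
    · have : t = T := by tauto
      subst this
      exact ⟨t + 1, le_rfl, Or.inl rfl, by have := hs t; omega⟩

lemma sq_le_two_pow (n : ℕ) : n * n ≤ 2 ^ (n + 4) := by
  induction n with
  | zero => simp
  | succ n ih =>
    have h1 : n < 2 ^ n := Nat.lt_two_pow_self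
    have h2 : 2 ^ (n + 1 + 4) = 2 ^ (n + 4) + 16 * 2 ^ n := by ring
    rw [h2]
    nlinarith

lemma growth (a b : ℕ) : ∃ N0, ∀ N, N0 ≤ N → a * N + b < 2 ^ N := by
  refine ⟨5 * a + b + 10, fun N hN => ?_⟩
  obtain ⟨n, rfl⟩ : ∃ n, N = n + 4 := ⟨N - 4, by omega⟩
  have := sq_le_two_pow n
  refine lt_of_lt_of_le ?_ this
  have h : 5 * a + b + 6 ≤ n := by omega
  have h2 : (5 * a + b + 6) * n ≤ n * n := Nat.mul_le_mul_right _ h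
  nlinarith

/-- The numerical bound coming from the logarithmic estimate. -/
lemma exists_bound (K M L : ℕ) : ∃ D0 : ℕ, ∀ D : ℕ,
    (∀ N, 8 * D + 2 * L ≤ 2 ^ N → D ≤ K * N + M) → D ≤ D0 := by
  obtain ⟨N0, hN0⟩ := growth (16 * K) (16 * M + 4 * L)
  refine ⟨2 ^ N0, fun D hD => ?_⟩
  by_contra hlt
  push Not at hlt
  have hex : ∃ N, 8 * D + 2 * L ≤ 2 ^ N := ⟨8 * D + 2 * L, Nat.lt_two_pow_self.le⟩
  classical
  have hs := Nat.find_spec hex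
  have hmin := fun k => @Nat.find_min _ _ hex k
  set N := Nat.find hex
  have h1 : N0 < N := by
    by_contra hc
    have : 2 ^ N ≤ 2 ^ N0 := Nat.pow_le_pow_right (by norm_num) (by omega)
    omega
  have h2 := hN0 N h1.le
  have h3 := hmin (N - 1) (by omega)
  have h4 : 2 ^ N = 2 * 2 ^ (N - 1) := by
    rw [← pow_succ']
    congr 1
    omega
  have h5 := hD N hs
  have h6 : 16 * K * N = 16 * (K * N) := by ring
  omega

/-- Connecting an exit point to the geodesic, staying away from `w`. -/
lemma connect {Y : SimpleGraph W} (hY : Y.Preconnected) {a b : W} (q : Y.Walk a b) (D : ℕ)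
    (w w1 : W) (hw : ∀ z ∈ q.support, D ≤ Y.dist w z)
    (hw1 : ∃ z ∈ q.support, Y.dist w1 z ≤ D)
    (h : w1 ∈ q.support ∨ 2 * D ≤ Y.dist w1 w) :
    ∃ z ∈ q.support, ∃ c : Y.Walk w1 z, c.length ≤ D ∧ ∀ v ∈ c.support, D ≤ Y.dist w v := by
  rcases h with h | h
  · refine ⟨w1, h, Walk.nil, by simp, ?_⟩
    intro v hv
    simp only [Walk.support_nil, List.mem_singleton] at hv
    exact hv ▸ hw w1 h
  · obtain ⟨z, hz, hd⟩ := hw1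
    obtain ⟨c, hc⟩ := exists_geod hY w1 z
    refine ⟨z, hz, c, by unfold IsGeodesicWalk at hc; omega, ?_⟩
    intro v hv
    have h1 := btw_of_mem hY c hc hv
    unfold Btw at h1
    have h2 := tri hY w1 v w
    rw [SimpleGraph.dist_comm (u := v) (v := w)] at h2
    omega

lemma image_near {X : SimpleGraph V} {Y : SimpleGraph W} {K M L D0 : ℕ} {f : V → W}
    (hX : X.Preconnected)
    (hY : Y.Preconnected) (hf : Function.Surjective f)
    (hlip : ∀ a b, Y.dist (f a) (f b) ≤ L * X.dist a b)
    (hthin : ∀ x y z m, Btw X x y m →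
      ∃ m', (Btw X x z m' ∨ Btw X z y m') ∧ Y.dist (f m) (f m') ≤ K)
    (hdiam : ∀ x y m, Btw X x y m → Y.dist (f x) (f y) ≤ 1 → Y.dist (f m) (f x) ≤ M)
    (hD0 : ∀ D : ℕ, (∀ N, 8 * D + 2 * L ≤ 2 ^ N → D ≤ K * N + M) → D ≤ D0)
    (x y : V) (p : X.Walk x y) (hp : IsGeodesicWalk X p) (q : Y.Walk (f x) (f y))
    (hq : IsGeodesicWalk Y q) :
    ∀ k ≤ p.length, ∃ z ∈ q.support, Y.dist (f (p.getVert k)) z ≤ D0 := by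
  classical
  have hex : ∃ D, ∀ k ≤ p.length, ∃ z ∈ q.support, Y.dist (f (p.getVert k)) z ≤ D := by
    refine ⟨L * p.length, fun k hk => ⟨f x, q.start_mem_support, ?_⟩⟩
    have h1 := dist_getVert_le p 0 k (Nat.zero_le _)
    rw [Walk.getVert_zero, SimpleGraph.dist_comm] at h1
    exact (hlip _ _).trans (Nat.mul_le_mul_left _ (by omega))
  have hs := Nat.find_spec hex
  have hmin := fun k => @Nat.find_min _ _ hex k
  set D := Nat.find hex
  suffices hD : D ≤ D0 by
    intro k hk
    obtain ⟨z, hz, h⟩ := hs k hk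
    exact ⟨z, hz, h.trans hD⟩
  apply hD0
  intro N hN
  rcases Nat.eq_zero_or_pos D with h0 | hpos
  · omega
  have h1 := hmin (D - 1) (by omega)
  push Not at h1
  obtain ⟨k, hk, hfar⟩ := h1
  have hfar' : ∀ z ∈ q.support, D ≤ Y.dist (f (p.getVert k)) z := fun z hz => by
    have := hfar z hz
    omega
  have step : ∀ i, Y.dist (f (p.getVert i)) (f (p.getVert (i + 1))) ≤ L := fun i => by
    have h1 := dist_getVert_le p i (i + 1) (by omega)
    refine (hlip _ _).trans ?_
    calc _ ≤ L * 1 := Nat.mul_le_mul_left _ (by omega)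
      _ = L := by simp
  set w := f (p.getVert k) with hwdef
  -- backward exit
  obtain ⟨s, hs1, hs2, hs3⟩ := exits (fun t => Y.dist (f (p.getVert (k - t))) w) L (2 * D)
    (by simp [hwdef]) (fun t => by
      show Y.dist (f (p.getVert (k - (t + 1)))) w ≤ Y.dist (f (p.getVert (k - t))) w + L
      by_cases hkt : k ≤ t
      · have e : k - (t + 1) = k - t := by omega
        rw [e]
        omega
      · have e : k - t = (k - (t + 1)) + 1 := by omega
        rw [e]
        have := step (k - (t + 1))
        have := tri hY (f (p.getVert (k - (t + 1)))) (f (p.getVert (k - (t + 1) + 1))) w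
        omega) k
  -- forward exit
  obtain ⟨r, hr1, hr2, hr3⟩ := exits (fun t => Y.dist (f (p.getVert (k + t))) w) L (2 * D)
    (by simp [hwdef]) (fun t => by
      show Y.dist (f (p.getVert (k + (t + 1)))) w ≤ Y.dist (f (p.getVert (k + t))) w + L
      have h1 := step (k + t)
      rw [SimpleGraph.dist_comm] at h1
      have := tri hY (f (p.getVert (k + t + 1))) (f (p.getVert (k + t))) w
      rw [← add_assoc]
      omega) (p.length - k)

  obtain ⟨a, ha, c1, hc1, hc1'⟩ := connect hY q D w (f (p.getVert (k - s))) hfar'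
    (hs _ (by omega)) (by
      rcases hs2 with h | h
      · left
        rw [h, Nat.sub_self, Walk.getVert_zero]
        exact q.start_mem_support
      · exact Or.inr h)
  obtain ⟨b, hb, c2, hc2, hc2'⟩ := connect hY q D w (f (p.getVert (k + r))) hfar'
    (hs _ (by omega)) (by
      rcases hr2 with h | h
      · left
        rw [h, Nat.add_sub_cancel' hk, Walk.getVert_length]
        exact q.end_mem_support
      · exact Or.inr h)
  obtain ⟨c, hc, hc'⟩ := exists_sub_geod hY q hq ha hb
  have hab : Y.dist a b ≤ 6 * D + 2 * L := by
    have e1 := dist_le c1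
    have e2 := dist_le c2
    rw [SimpleGraph.dist_comm] at e1
    have e3 := tri hY a (f (p.getVert (k - s))) b
    have e4 := tri hY (f (p.getVert (k - s))) w b
    have e5 := tri hY w (f (p.getVert (k + r))) b
    rw [SimpleGraph.dist_comm (u := w) (v := f (p.getVert (k + r)))] at e5
    omega
  obtain ⟨z, hz, hd⟩ := log_lemma hY hf hthin hdiam N _ _ (c1.append (c.append c2.reverse))
    (by simp only [Walk.length_append, Walk.length_reverse]; omega)
    (p.getVert (k - s)) (p.getVert (k + r)) (p.getVert k) rfl rfl
    (btw_getVert hX p hp _ _ _ (by omega) (by omega) (by omega))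
  refine le_trans ?_ hd
  rw [Walk.mem_support_append_iff, Walk.mem_support_append_iff, Walk.support_reverse,
    List.mem_reverse] at hz
  rcases hz with hz | hz | hz
  · exact hc1' z hz
  · exact hfar' z (hc' z hz)
  · exact hc2' z hz

lemma crossing (g : ℕ → ℕ) (B j : ℕ) (n : ℕ) (h0 : g 0 ≤ j) (hn : j ≤ g n)
    (hs : ∀ t < n, g (t + 1) ≤ g t + B) : ∃ t ≤ n, g t ≤ j ∧ j ≤ g t + B := by
  induction n with
  | zero => exact ⟨0, le_rfl, h0, by omega⟩
  | succ n ih =>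
    by_cases h : j ≤ g n
    · obtain ⟨t, ht, h1⟩ := ih h (fun t ht => hs t (by omega))
      exact ⟨t, by omega, h1⟩
    · exact ⟨n, by omega, by omega, by have := hs n (by omega); omega⟩

lemma geod_near {X : SimpleGraph V} {Y : SimpleGraph W} {L D0 : ℕ} {f : V → W}
    (hY : Y.Preconnected)
    (hlip : ∀ a b, Y.dist (f a) (f b) ≤ L * X.dist a b)
    (x y : V) (p : X.Walk x y) (q : Y.Walk (f x) (f y))
    (hq : IsGeodesicWalk Y q)
    (hnear : ∀ k ≤ p.length, ∃ z ∈ q.support, Y.dist (f (p.getVert k)) z ≤ D0) :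
    ∀ z ∈ q.support, ∃ k ≤ p.length, Y.dist z (f (p.getVert k)) ≤ L + 3 * D0 := by
  -- index of a nearby point, as the distance from the start
  intro z hz
  obtain ⟨j, rfl, hj⟩ := Walk.mem_support_iff_exists_getVert.1 hz
  have hidx : ∀ k, ∃ i, k ≤ p.length → i ≤ q.length ∧
      Y.dist (f (p.getVert k)) (q.getVert i) ≤ D0 := by
    intro k
    by_cases hk : k ≤ p.length
    · obtain ⟨z, hz, hd⟩ := hnear k hk
      obtain ⟨i, rfl, hi⟩ := Walk.mem_support_iff_exists_getVert.1 hz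
      exact ⟨i, fun _ => ⟨hi, hd⟩⟩
    · exact ⟨0, fun h => absurd h hk⟩
  choose g hg using hidx
  -- endpoints are within `D0` of the ends of `q`
  by_cases hj0 : j < g 0
  · have h1 := (hg 0 (Nat.zero_le _))
    have h2 := dist_getVert hY q hq 0 (g 0) (Nat.zero_le _) h1.1
    have h3 := dist_getVert hY q hq 0 j (Nat.zero_le _) hj
    rw [Walk.getVert_zero] at h1 h2 h3
    refine ⟨0, Nat.zero_le _, ?_⟩
    rw [Walk.getVert_zero, SimpleGraph.dist_comm]
    omega
  by_cases hjn : g p.length < j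
  · have h1 := (hg p.length le_rfl)
    have h2 := dist_getVert hY q hq (g p.length) q.length h1.1 le_rfl
    have h3 := dist_getVert hY q hq j q.length hj le_rfl
    rw [Walk.getVert_length] at h1 h2 h3
    refine ⟨p.length, le_rfl, ?_⟩
    rw [Walk.getVert_length]
    rw [SimpleGraph.dist_comm] at h2
    omega
  obtain ⟨t, ht, h1, h2⟩ := crossing g (L + 2 * D0) j p.length (by omega) (by omega) (by
    intro t ht
    obtain ⟨a1, a2⟩ := hg t (by omega)
    obtain ⟨b1, b2⟩ := hg (t + 1) (by omega)
    by_cases hle : g (t + 1) ≤ g t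
    · omega
    have h1 := dist_getVert_le p t (t + 1) (by omega)
    have h2 : Y.dist (f (p.getVert t)) (f (p.getVert (t + 1))) ≤ L := by
      refine (hlip _ _).trans ?_
      calc _ ≤ L * 1 := Nat.mul_le_mul_left _ (by omega)
        _ = L := by simp
    have h3 := dist_getVert hY q hq (g t) (g (t + 1)) (by omega) b1
    have h4 := tri hY (q.getVert (g t)) (f (p.getVert t)) (q.getVert (g (t + 1)))
    have h5 := tri hY (f (p.getVert t)) (f (p.getVert (t + 1))) (q.getVert (g (t + 1)))
    rw [SimpleGraph.dist_comm] at a2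
    omega)
  obtain ⟨a1, a2⟩ := hg t ht
  refine ⟨t, ht, ?_⟩
  have h3 := dist_getVert hY q hq (g t) j h1 hj
  have h4 := tri hY (q.getVert j) (q.getVert (g t)) (f (p.getVert t))
  rw [SimpleGraph.dist_comm] at a2 h3
  omega

end HypContr

/-- pushing hyperbolicity through a coarsely-contracting Lipschitz map. -/
theorem hyperbolicity_of_contraction (δ₀ : ℝ) (hδ₀ : 0 ≤ δ₀) (L : ℕ)
    (M₁ M₂ : ℕ) (hM₁ : 0 < M₁) (hM₂ : 0 < M₂) :
    ∃ δ₁ H : ℝ, 0 < δ₁ ∧ 0 < H ∧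
      ∀ (V : Type u) (W : Type v) (X : SimpleGraph V) (Y : SimpleGraph W),
        X.Preconnected → Y.Preconnected → ThinTriangles X δ₀ →
        ∀ f : V → W, IsLipschitzGraphMap X Y L f → Function.Surjective f →
        (∀ x y : V, Y.dist (f x) (f y) ≤ M₁ →
          ∀ p : X.Walk x y, IsGeodesicWalk X p →
            SetDiamLE Y (f '' walkSet p) (M₂ : ℝ)) →
        ThinTriangles Y δ₁ ∧
        ∀ x y : V, ∀ p : X.Walk x y, IsGeodesicWalk X p →
          ∀ q : Y.Walk (f x) (f y), IsGeodesicWalk Y q →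
            HausClose Y H (f '' walkSet p) (walkSet q) := by
  classical
  obtain ⟨D0, hD0⟩ := HypContr.exists_bound (L * ⌊δ₀⌋₊) M₂ L
  refine ⟨(2 * (L + 3 * D0) + L * ⌊δ₀⌋₊ + 1 : ℕ), (L + 3 * D0 + 1 : ℕ), by positivity,
    by positivity, ?_⟩
  intro V W X Y hX hY hXthin f hf hsurj hcontr
  have hlip := HypContr.lip hX hY hf
  have key : ∀ m m', (X.dist m m' : ℝ) ≤ δ₀ → Y.dist (f m) (f m') ≤ L * ⌊δ₀⌋₊ := by
    intro m m' h
    exact (hlip m m').trans (Nat.mul_le_mul_left _ (Nat.le_floor h))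
  have hthin : ∀ x y z m, HypContr.Btw X x y m →
      ∃ m', (HypContr.Btw X x z m' ∨ HypContr.Btw X z y m') ∧
        Y.dist (f m) (f m') ≤ L * ⌊δ₀⌋₊ := by
    intro x y z m hm
    obtain ⟨p, hp, hmp⟩ := HypContr.mem_of_btw hX hm
    obtain ⟨q, hq⟩ := HypContr.exists_geod hX x z
    obtain ⟨r, hr⟩ := HypContr.exists_geod hX z y
    obtain ⟨m', hm', hd⟩ := (hXthin x z y q r p hq hr hp).2.2 m hmp
    refine ⟨m', ?_, key _ _ hd⟩
    rcases hm' with h | h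
    · exact Or.inl (HypContr.btw_of_mem hX q hq h)
    · exact Or.inr (HypContr.btw_of_mem hX r hr h)
  have hdiam : ∀ x y m, HypContr.Btw X x y m → Y.dist (f x) (f y) ≤ 1 →
      Y.dist (f m) (f x) ≤ M₂ := by
    intro x y m hm hd
    obtain ⟨p, hp, hmp⟩ := HypContr.mem_of_btw hX hm
    have := hcontr x y (by omega) p hp (f m) ⟨m, hmp, rfl⟩ (f x) ⟨x, p.start_mem_support, rfl⟩
    exact_mod_cast this
  have near1 : ∀ x y : V, ∀ p : X.Walk x y, IsGeodesicWalk X p →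
      ∀ q : Y.Walk (f x) (f y), IsGeodesicWalk Y q →
        ∀ m ∈ p.support, ∃ z ∈ q.support, Y.dist (f m) z ≤ D0 := by
    intro x y p hp q hq m hm
    obtain ⟨k, rfl, hk⟩ := SimpleGraph.Walk.mem_support_iff_exists_getVert.1 hm
    exact HypContr.image_near hX hY hsurj hlip hthin hdiam hD0 x y p hp q hq k hk
  have near2 : ∀ x y : V, ∀ p : X.Walk x y, IsGeodesicWalk X p →
      ∀ q : Y.Walk (f x) (f y), IsGeodesicWalk Y q →
        ∀ z ∈ q.support, ∃ m ∈ p.support, Y.dist z (f m) ≤ L + 3 * D0 := by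
    intro x y p hp q hq z hz
    obtain ⟨k, hk, hd⟩ := HypContr.geod_near hY hlip x y p q hq
      (HypContr.image_near hX hY hsurj hlip hthin hdiam hD0 x y p hp q hq) z hz
    exact ⟨_, p.getVert_mem_support k, hd⟩
  -- one side of a triangle, in terms of the intermediate images
  have side : ∀ z m m' z', Y.dist z (f m) ≤ L + 3 * D0 → (X.dist m m' : ℝ) ≤ δ₀ →
      Y.dist (f m') z' ≤ D0 →
      (Y.dist z z' : ℝ) ≤ (2 * (L + 3 * D0) + L * ⌊δ₀⌋₊ + 1 : ℕ) := by
    intro z m m' z' h1 h2 h3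
    have h4 := key _ _ h2
    have h5 := HypContr.tri hY z (f m) z'
    have h6 := HypContr.tri hY (f m) (f m') z'
    have : Y.dist z z' ≤ 2 * (L + 3 * D0) + L * ⌊δ₀⌋₊ + 1 := by omega
    exact_mod_cast this
  refine ⟨?_, ?_⟩
  · intro a b c p q r hp hq hr
    obtain ⟨x, rfl⟩ := hsurj a
    obtain ⟨y, rfl⟩ := hsurj b
    obtain ⟨z, rfl⟩ := hsurj c
    obtain ⟨p', hp'⟩ := HypContr.exists_geod hX x y
    obtain ⟨q', hq'⟩ := HypContr.exists_geod hX y z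
    obtain ⟨r', hr'⟩ := HypContr.exists_geod hX x z
    obtain ⟨t1, t2, t3⟩ := hXthin x y z p' q' r' hp' hq' hr'
    refine ⟨?_, ?_, ?_⟩
    · intro v hv
      obtain ⟨m, hm, hd⟩ := near2 _ _ p' hp' p hp v hv
      obtain ⟨m', hm', hd'⟩ := t1 m hm
      rcases hm' with hm' | hm'
      · obtain ⟨v', hv', e⟩ := near1 _ _ q' hq' q hq m' hm'
        exact ⟨v', Or.inl hv', side _ _ _ _ hd hd' e⟩
      · obtain ⟨v', hv', e⟩ := near1 _ _ r' hr' r hr m' hm'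
        exact ⟨v', Or.inr hv', side _ _ _ _ hd hd' e⟩
    · intro v hv
      obtain ⟨m, hm, hd⟩ := near2 _ _ q' hq' q hq v hv
      obtain ⟨m', hm', hd'⟩ := t2 m hm
      rcases hm' with hm' | hm'
      · obtain ⟨v', hv', e⟩ := near1 _ _ p' hp' p hp m' hm'
        exact ⟨v', Or.inl hv', side _ _ _ _ hd hd' e⟩
      · obtain ⟨v', hv', e⟩ := near1 _ _ r' hr' r hr m' hm'
        exact ⟨v', Or.inr hv', side _ _ _ _ hd hd' e⟩
    · intro v hv
      obtain ⟨m, hm, hd⟩ := near2 _ _ r' hr' r hr v hv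
      obtain ⟨m', hm', hd'⟩ := t3 m hm
      rcases hm' with hm' | hm'
      · obtain ⟨v', hv', e⟩ := near1 _ _ p' hp' p hp m' hm'
        exact ⟨v', Or.inl hv', side _ _ _ _ hd hd' e⟩
      · obtain ⟨v', hv', e⟩ := near1 _ _ q' hq' q hq m' hm'
        exact ⟨v', Or.inr hv', side _ _ _ _ hd hd' e⟩
  · intro x y p hp q hq
    refine ⟨?_, ?_⟩
    · rintro _ ⟨m, hm, rfl⟩
      obtain ⟨z, hz, hd⟩ := near1 x y p hp q hq m hm
      refine ⟨z, hz, ?_⟩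
      exact_mod_cast (show Y.dist (f m) z ≤ L + 3 * D0 + 1 by omega)
    · intro z hz
      obtain ⟨m, hm, hd⟩ := near2 x y p hp q hq z hz
      refine ⟨f m, ⟨m, hm, rfl⟩, ?_⟩
      exact_mod_cast (show Y.dist z (f m) ≤ L + 3 * D0 + 1 by omega)
end

section
/- For any positive integers δ_0, L, M and D there exist δ_1 > 0 and H > 0 so that the following holds. Let X, Y be connected graphs with their simplicial metrics such that X is δ_0-hyperbolic, and let f : X → Y be an L-Lipschitz graph-map. Let S ⊆ V(X) be a set of vertices such that: (1) f(S) = V(Y); (2) S is D-dense in X (every point of X is within distance D of a point of S); (3) for all x, y ∈ S, if d_Y(f(x), f(y)) ≤ 1 then for any geodesic [x,y] in X one has diam_Y(f([x,y])) ≤ M. Then Y is δ_1-hyperbolic, and for any vertices x, y of X and any geodesic [x,y] in X, the path f([x,y]) is H-Hausdorff-close to any geodesic from f(x) to f(y) in Y. -/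
/-!
STATEMENT 9: For any positive integers `δ₀, L, M, D` there exist `δ₁ > 0` and `H > 0`
so that: if `X`, `Y` are connected graphs, `X` is `δ₀`-hyperbolic, `f : X → Y` is an
`L`-Lipschitz graph-map, and `S ⊆ V(X)` satisfies `f(S) = V(Y)`, `S` is `D`-dense in
`X`, and `diam_Y(f([x,y])) ≤ M` whenever `x, y ∈ S` with `d_Y(f x, f y) ≤ 1`, then
`Y` is `δ₁`-hyperbolic and for all vertices `x, y` of `X`, the image `f([x,y])` of any
geodesic is `H`-Hausdorff-close to any geodesic from `f x` to `f y` in `Y`.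
-/

universe u v

section Helpers

variable {V : Type*} {W : Type*}

theorem aux_const (E M : ℕ) : ∃ k : ℕ,
    2 * (2 * (2 * E + k * E + M) + 3 * E + M + 1) ≤ 2 ^ k := by
  set c := 14 * E + 6 * M + 2 with hc
  refine ⟨2 * (c + 3), ?_⟩
  have h1 : ∀ m : ℕ, 2 * (m + 3) + 1 ≤ 2 ^ (m + 3) := by
    intro m
    induction m with
    | zero => norm_num
    | succ n ih =>
      have : 2 ^ (n + 1 + 3) = 2 * 2 ^ (n + 3) := by ring
      omega
  have h2 : c ≤ 2 ^ (c + 3) := by have := h1 c; omega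
  have h3 : c * (2 * (c + 3) + 1) ≤ 2 ^ (c + 3) * 2 ^ (c + 3) := Nat.mul_le_mul h2 (h1 c)
  have h4 : (2 : ℕ) ^ (2 * (c + 3)) = 2 ^ (c + 3) * 2 ^ (c + 3) := by
    rw [two_mul, pow_add]
  rw [h4]
  refine le_trans ?_ h3
  generalize 2 * (c + 3) = k
  rw [hc]
  nlinarith [Nat.zero_le (k * E), Nat.zero_le (k * M), Nat.zero_le k, Nat.zero_le E, Nat.zero_le M]

/-- Logarithmic bound: guessed paths are close to arbitrary paths. -/
theorem aux_log (d : W → W → ℕ) (tri : ∀ a b c, d a c ≤ d a b + d b c)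
    (f : V → W) (S : Set V) (hS : ∀ w, ∃ s ∈ S, f s = w) (A : V → V → Set W) (E M : ℕ)
    (thin : ∀ x y z, ∀ w ∈ A x y, ∃ u, (u ∈ A x z ∨ u ∈ A z y) ∧ d w u ≤ E)
    (hM : ∀ x ∈ S, ∀ y ∈ S, d (f x) (f y) ≤ 1 → ∀ w ∈ A x y, d w (f x) ≤ M)
    (g : ℕ → W) (hg : ∀ i, d (g i) (g (i + 1)) ≤ 1) (hg0 : ∀ i, d (g i) (g i) = 0) (k : ℕ) :
    ∀ i j, i ≤ j → j ≤ i + 2 ^ k → ∀ x ∈ S, ∀ y ∈ S, f x = g i → f y = g j →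
      ∀ w ∈ A x y, ∃ m, i ≤ m ∧ m ≤ j ∧ d w (g m) ≤ k * E + M := by
  induction k with
  | zero =>
    intro i j hij hj x hx y hy hxi hyj w hw
    refine ⟨i, le_rfl, hij, ?_⟩
    have : d (f x) (f y) ≤ 1 := by
      rw [hxi, hyj]
      have : j = i ∨ j = i + 1 := by simp at hj; omega
      rcases this with rfl | rfl
      · rw [hg0]; omega
      · exact hg i
    have := hM x hx y hy this w hw
    rw [hxi] at this
    omega
  | succ k ih =>
    intro i j hij hj x hx y hy hxi hyj w hw
    have hp : 2 ^ (k + 1) = 2 * 2 ^ k := by ring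
    obtain ⟨c, hc1, hc2, hc3, hc4⟩ : ∃ c, i ≤ c ∧ c ≤ j ∧ c ≤ i + 2 ^ k ∧ j ≤ c + 2 ^ k := by
      by_cases h : j ≤ i + 2 ^ k
      · exact ⟨j, hij, le_rfl, h, by omega⟩
      · exact ⟨i + 2 ^ k, by omega, by omega, le_rfl, by omega⟩
    obtain ⟨z, hz, hzc⟩ := hS (g c)
    obtain ⟨u, hu, hwu⟩ := thin x y z w hw
    have e : (k + 1) * E + M = k * E + M + E := by ring
    rcases hu with hu | hu
    · obtain ⟨m, h1, h2, h3⟩ := ih i c hc1 hc3 x hx z hz hxi hzc u hu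
      exact ⟨m, h1, by omega, by have := tri w u (g m); omega⟩
    · obtain ⟨m, h1, h2, h3⟩ := ih c j hc2 hc4 z hz y hy hzc hyj u hu
      exact ⟨m, by omega, h2, by have := tri w u (g m); omega⟩

/-- Guessed paths are uniformly close to geodesics. -/
theorem aux_near (d : W → W → ℕ) (tri : ∀ a b c, d a c ≤ d a b + d b c)
    (sym : ∀ a b, d a b = d b a)
    (f : V → W) (hf : ∀ w, ∃ s, f s = w) (A : V → V → Set W) (E M k H : ℕ)
    (hH : H = 2 * E + k * E + M) (hk : 2 * (2 * H + 3 * E + M + 1) ≤ 2 ^ k)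
    (thin : ∀ x y z, ∀ w ∈ A x y, ∃ u, (u ∈ A x z ∨ u ∈ A z y) ∧ d w u ≤ E)
    (hM : ∀ x y, d (f x) (f y) ≤ 1 → ∀ w ∈ A x y, d w (f x) ≤ M ∧ d w (f y) ≤ M)
    (g : ℕ → W) (hg : ∀ i, d (g i) (g (i + 1)) ≤ 1) (hg0 : ∀ i, d (g i) (g i) = 0)
    (N : ℕ) (hN : ∀ i j, i ≤ j → j ≤ N → d (g i) (g j) + i = j) (n : ℕ) :
    ∀ i j, i ≤ j → j ≤ N → j ≤ i + n → ∀ x y, f x = g i → f y = g j →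
      ∀ w ∈ A x y, ∃ m, i ≤ m ∧ m ≤ j ∧ d w (g m) ≤ H := by
  induction n with
  | zero =>
    intro i j hij hjN hj x y hxi hyj w hw
    obtain rfl : j = i := by omega
    have := (hM x y (by rw [hxi, hyj, hg0]; omega) w hw).1
    rw [hxi] at this
    exact ⟨j, le_rfl, le_rfl, by omega⟩
  | succ n ih =>
    intro i j hij hjN hj x y hxi hyj w hw
    by_cases hjn : j ≤ i + n
    · exact ih i j hij hjN hjn x y hxi hyj w hw
    obtain ⟨m, him, hmj, hwm⟩ : ∃ m, i ≤ m ∧ m ≤ j ∧ d w (g m) ≤ H + E + M := by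
      obtain ⟨z, hz⟩ := hf (g (i + n))
      obtain ⟨u, hu, hwu⟩ := thin x y z w hw
      rcases hu with hu | hu
      · obtain ⟨m, h1, h2, h3⟩ := ih i (i + n) (by omega) (by omega) le_rfl x z hxi hz u hu
        exact ⟨m, h1, by omega, by have := tri w u (g m); omega⟩
      · have hj' : j = i + n + 1 := by omega
        have := (hM z y (by rw [hz, hyj, hj']; exact hg _) u hu).2
        rw [hyj] at this
        exact ⟨j, hij, le_rfl, by have := tri w u (g j); omega⟩
    set t := 2 * H + 3 * E + M + 1 with ht
    obtain ⟨a, ha1, ha2, ha3⟩ : ∃ a, i ≤ a ∧ a ≤ m ∧ m ≤ a + t ∧ (a = i ∨ a + t = m) := by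
      by_cases h : m ≤ i + t
      · exact ⟨i, by omega, by omega, by omega, by omega⟩
      · exact ⟨m - t, by omega, by omega, by omega, by omega⟩
    obtain ⟨b, hb1, hb2, hb3⟩ : ∃ b, m ≤ b ∧ b ≤ j ∧ b ≤ m + t ∧ (b = j ∨ b = m + t) := by
      by_cases h : j ≤ m + t
      · exact ⟨j, by omega, by omega, by omega, by omega⟩
      · exact ⟨m + t, by omega, by omega, by omega, by omega⟩
    obtain ⟨z1, hz1⟩ := hf (g a)
    obtain ⟨z2, hz2⟩ := hf (g b)
    obtain ⟨u, hu, hwu⟩ := thin x y z1 w hw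
    rcases hu with hu | hu
    · rcases ha3.2 with h | h
      · have := (hM x z1 (by rw [hxi, hz1, h, hg0]; omega) u hu).1
        rw [hxi] at this
        exact ⟨i, le_rfl, hij, by have := tri w u (g i); omega⟩
      · obtain ⟨m', h1, h2, h3⟩ := ih i a ha1 (by omega) (by omega) x z1 hxi hz1 u hu
        have e1 := hN m' m (by omega) (by omega)
        have e2 := tri (g m') u (g m)
        have e3 := tri u w (g m)
        rw [sym (g m') u] at e2
        rw [sym u w] at e3
        omega
    · obtain ⟨v, hv, huv⟩ := thin z1 y z2 u hu
      have hwv := tri w u v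
      rcases hv with hv | hv
      · obtain ⟨m', h1, h2, h3⟩ := aux_log d tri f Set.univ
          (fun w => by simpa using hf w) A E M thin
          (fun x _ y _ h w hw => (hM x y h w hw).1) g hg hg0 k a b (by omega) (by omega)
          z1 trivial z2 trivial hz1 hz2 v hv
        exact ⟨m', by omega, by omega, by have := tri w v (g m'); omega⟩
      · rcases hb3.2 with h | h
        · have := (hM z2 y (by rw [hyj, hz2, h, hg0]; omega) v hv).2
          rw [hyj] at this
          exact ⟨j, hij, le_rfl, by have := tri w v (g j); omega⟩
        · obtain ⟨m', h1, h2, h3⟩ := ih b j hb2 (by omega) (by omega) z2 y hz2 hyj v hv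
          have e1 := hN m m' (by omega) (by omega)
          have e2 := tri (g m) w (g m')
          have e3 := tri w v (g m')
          rw [sym (g m) w] at e2
          omega

/-- Geodesics are close to coarse paths which are close to them. -/
theorem aux_conv (d : W → W → ℕ) (tri : ∀ a b c, d a c ≤ d a b + d b c)
    (sym : ∀ a b, d a b = d b a) (H L : ℕ)
    (g : ℕ → W) (N : ℕ) (hN : ∀ i j, i ≤ j → j ≤ N → d (g i) (g j) + i = j)
    (h : ℕ → W) (P : ℕ) (hh : ∀ i, d (h i) (h (i + 1)) ≤ L)
    (h0 : h 0 = g 0) (hP : h P = g N)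
    (near : ∀ i ≤ P, ∃ m ≤ N, d (h i) (g m) ≤ H) (j : ℕ) (hj : j ≤ N) :
    ∃ i ≤ P, d (g j) (h i) ≤ 3 * H + L := by
  classical
  have ex : ∃ i, ∃ m, j ≤ m ∧ m ≤ N ∧ d (h i) (g m) ≤ H :=
    ⟨P, N, hj, le_rfl, by rw [hP]; have := hN N N le_rfl le_rfl; omega⟩
  have hle : Nat.find ex ≤ P :=
    Nat.find_min' ex ⟨N, hj, le_rfl, by rw [hP]; have := hN N N le_rfl le_rfl; omega⟩
  obtain ⟨m, hm1, hm2, hm3⟩ := Nat.find_spec ex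
  refine ⟨Nat.find ex, hle, ?_⟩
  rcases hi : Nat.find ex with _ | i
  · rw [hi, h0] at hm3
    have := hN 0 m (by omega) hm2
    have h2 := hN 0 j (by omega) hj
    rw [h0, sym]
    omega
  · have hn := Nat.find_min ex (m := i) (by omega)
    rw [hi] at hm3 hle
    obtain ⟨m', hm'1, hm'2⟩ := near i (by omega)
    have hlt : m' < j := by
      by_contra hc
      exact hn ⟨m', by omega, hm'1, hm'2⟩
    have e1 := hN m' m (by omega) hm2
    have e2 := hN j m hm1 hm2
    have e3 := tri (g m') (h i) (g m)
    have e4 := tri (h i) (h (i + 1)) (g m)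
    have e5 := hh i
    have e6 := tri (g j) (g m) (h (i + 1))
    rw [sym (g m') (h i)] at e3
    rw [sym (g m) (h (i + 1))] at e6
    omega

theorem aux_tri {G : SimpleGraph V} (hG : G.Preconnected) (a b c : V) :
    G.dist a c ≤ G.dist a b + G.dist b c := by
  haveI : Nonempty V := ⟨a⟩
  exact (SimpleGraph.Connected.mk hG).dist_triangle

theorem aux_geo {G : SimpleGraph V} (hG : G.Preconnected) {a b : V} (p : G.Walk a b)
    (hp : IsGeodesicWalk G p) (i j : ℕ) (hij : i ≤ j) (hj : j ≤ p.length) :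
    G.dist (p.getVert i) (p.getVert j) + i = j := by
  have h1 : ∀ i j, i ≤ j → G.dist (p.getVert i) (p.getVert j) + i ≤ j := by
    intro i j hij
    induction j, hij using Nat.le_induction with
    | base => simp
    | succ n hn ih =>
      have := aux_tri hG (p.getVert i) (p.getVert n) (p.getVert (n + 1))
      have h2 : G.dist (p.getVert n) (p.getVert (n + 1)) ≤ 1 := by
        by_cases h : n < p.length
        · exact (SimpleGraph.dist_eq_one_iff_adj.2 (p.adj_getVert_succ h)).le
        · rw [p.getVert_of_length_le (by omega), p.getVert_of_length_le (by omega)]; simp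
      omega
  have e1 := h1 0 i (by omega)
  have e2 := h1 i j hij
  have e3 := h1 j p.length hj
  have e4 := aux_tri hG (p.getVert 0) (p.getVert i) (p.getVert p.length)
  have e5 := aux_tri hG (p.getVert i) (p.getVert j) (p.getVert p.length)
  have e6 : p.length = G.dist (p.getVert 0) (p.getVert p.length) := by
    rw [p.getVert_zero, p.getVert_length]; exact hp
  omega

theorem aux_step {G : SimpleGraph V} {a b : V} (p : G.Walk a b) (n : ℕ) :
    G.dist (p.getVert n) (p.getVert (n + 1)) ≤ 1 := by
  by_cases h : n < p.length
  · exact (SimpleGraph.dist_eq_one_iff_adj.2 (p.adj_getVert_succ h)).le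
  · rw [p.getVert_of_length_le (by omega), p.getVert_of_length_le (by omega)]; simp

theorem aux_lip {X : SimpleGraph V} {Y : SimpleGraph W} (hX : X.Preconnected)
    (hY : Y.Preconnected) {L : ℕ} {f : V → W} (hf : IsLipschitzGraphMap X Y L f) (a b : V) :
    Y.dist (f a) (f b) ≤ L * X.dist a b := by
  obtain ⟨p, hp⟩ := (hX a b).exists_walk_length_eq_dist
  rw [← hp]
  clear hp
  induction p with
  | nil => simp
  | @cons u v w h p ih =>
    have := aux_tri hY (f u) (f v) (f w)
    have h2 := (hf u v h).2
    rw [SimpleGraph.Walk.length_cons, mul_add]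
    omega

/-- The union of the images of all geodesics from `x` to `y`. -/
def geoImg (X : SimpleGraph V) (f : V → W) (x y : V) : Set W :=
  {w | ∃ p : X.Walk x y, IsGeodesicWalk X p ∧ ∃ v ∈ p.support, f v = w}

theorem geoImg_symm (X : SimpleGraph V) (f : V → W) (x y : V) (w : W)
    (h : w ∈ geoImg X f x y) : w ∈ geoImg X f y x := by
  obtain ⟨p, hp, v, hv, rfl⟩ := h
  refine ⟨p.reverse, ?_, v, by simpa using hv, rfl⟩
  unfold IsGeodesicWalk at *
  rw [SimpleGraph.Walk.length_reverse, hp, SimpleGraph.dist_comm]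

theorem geoImg_thin {X : SimpleGraph V} {Y : SimpleGraph W} (hX : X.Preconnected)
    (hY : Y.Preconnected) {L δ : ℕ} {f : V → W} (hf : IsLipschitzGraphMap X Y L f)
    (hT : ThinTriangles X (δ : ℝ)) (x y z : V) (w : W) (hw : w ∈ geoImg X f x y) :
    ∃ u, (u ∈ geoImg X f x z ∨ u ∈ geoImg X f z y) ∧ Y.dist w u ≤ L * δ := by
  obtain ⟨r, hr, v, hv, rfl⟩ := hw
  obtain ⟨p, hp⟩ := (hX x z).exists_walk_length_eq_dist
  obtain ⟨q, hq⟩ := (hX z y).exists_walk_length_eq_dist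
  obtain ⟨u, hu, hd⟩ := (hT x z y p q r hp hq hr).2.2 v hv
  have hd' : X.dist v u ≤ δ := by exact_mod_cast hd
  refine ⟨f u, ?_, (aux_lip hX hY hf v u).trans (Nat.mul_le_mul_left _ hd')⟩
  rcases hu with hu | hu
  · exact Or.inl ⟨p, hp, u, hu, rfl⟩
  · exact Or.inr ⟨q, hq, u, hu, rfl⟩

theorem geoImg_near {X : SimpleGraph V} {Y : SimpleGraph W} (hX : X.Preconnected)
    (hY : Y.Preconnected) {L : ℕ} {f : V → W} (hf : IsLipschitzGraphMap X Y L f)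
    (x y : V) (w : W) (hw : w ∈ geoImg X f x y) : Y.dist w (f x) ≤ L * X.dist x y := by
  obtain ⟨p, hp, v, hv, rfl⟩ := hw
  obtain ⟨n, rfl, hn⟩ := (SimpleGraph.Walk.mem_support_iff_exists_getVert).1 hv
  refine (aux_lip hX hY hf _ _).trans (Nat.mul_le_mul_left _ ?_)
  have := aux_geo hX p hp 0 n (by omega) hn
  rw [p.getVert_zero, SimpleGraph.dist_comm] at this
  rw [← hp]
  omega

/-- The hypothesis on `S` upgrades to all vertices. -/
theorem aux_upgrade {X : SimpleGraph V} {Y : SimpleGraph W} (hX : X.Preconnected)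
    (hY : Y.Preconnected) {L δ M D : ℕ} {f : V → W} (hf : IsLipschitzGraphMap X Y L f)
    (hT : ThinTriangles X (δ : ℝ)) (S : Set V) (hS : f '' S = Set.univ)
    (hD : ∀ v : V, ∃ s ∈ S, X.dist v s ≤ D)
    (h3 : ∀ x ∈ S, ∀ y ∈ S, Y.dist (f x) (f y) ≤ 1 → ∀ p : X.Walk x y, IsGeodesicWalk X p →
              SetDiamLE Y (f '' walkSet p) (M : ℝ)) (x y : V)
    (hxy : Y.dist (f x) (f y) ≤ 1) (w : W) (hw : w ∈ geoImg X f x y) :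
    Y.dist w (f x) ≤ 2 * (L * δ) + ((2 * (L * D) + 1) * (L * δ) + M) + 3 * (L * D) + 2 := by
  have tri := aux_tri hY
  have thin := geoImg_thin hX hY hf hT
  obtain ⟨x', hx', hdx⟩ := hD x
  obtain ⟨y', hy', hdy⟩ := hD y
  have lx := (aux_lip hX hY hf x x').trans (Nat.mul_le_mul_left L hdx)
  have ly := (aux_lip hX hY hf y y').trans (Nat.mul_le_mul_left L hdy)
  have lx2 := Y.dist_comm (u := f x) (v := f x')
  have ly2 := Y.dist_comm (u := f y) (v := f y')
  have lxy2 := Y.dist_comm (u := f x) (v := f y)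
  obtain ⟨u, hu, hwu⟩ := thin x y x' w hw
  have t1 := tri w u (f x)
  rcases hu with hu | hu
  · have := (geoImg_near hX hY hf _ _ _ hu).trans (Nat.mul_le_mul_left L hdx)
    omega
  obtain ⟨v, hv, huv⟩ := thin x' y y' u hu
  have t2 := tri u v (f x)
  rcases hv with hv | hv
  · obtain ⟨q, hq⟩ := (hY (f x') (f y')).exists_walk_length_eq_dist
    have t3 := tri (f x') (f x) (f y')
    have t4 := tri (f x) (f y) (f y')
    have hl : q.length ≤ 2 * (L * D) + 1 := by omega
    have hl2 : 2 * (L * D) + 1 < 2 ^ (2 * (L * D) + 1) := Nat.lt_two_pow_self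
    obtain ⟨m, -, hm, hvm⟩ := aux_log Y.dist tri f S
      (fun w => by have : w ∈ f '' S := by rw [hS]; trivial
                   exact this) (geoImg X f) (L * δ) M thin
      (fun a ha b hb hab w hw => by
        obtain ⟨p, hp, v, hv, rfl⟩ := hw
        have := h3 a ha b hb hab p hp (f v) ⟨v, hv, rfl⟩ (f a) ⟨a, p.start_mem_support, rfl⟩
        exact_mod_cast this) q.getVert (aux_step q) (fun i => by simp) (2 * (L * D) + 1)
      0 q.length (by omega) (by omega) x' hx' y' hy' (by simp) (by simp) v hv
    have t5 := aux_geo hY q hq 0 m (by omega) hm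
    rw [q.getVert_zero, SimpleGraph.dist_comm] at t5
    have t6 := tri v (q.getVert m) (f x)
    have t7 := tri (q.getVert m) (f x') (f x)
    omega
  · have := (geoImg_near hX hY hf _ _ _ (geoImg_symm _ _ _ _ _ hv)).trans
      (Nat.mul_le_mul_left L hdy)
    have t3 := tri v (f y) (f x)
    omega

end Helpers

theorem hyperbolicity_of_image (δ₀ L M D : ℕ)
    (hδ₀ : 0 < δ₀) (hL : 0 < L) (hM : 0 < M) (hD : 0 < D) :
    ∃ δ₁ H : ℝ, 0 < δ₁ ∧ 0 < H ∧
      ∀ (V : Type u) (W : Type v) (X : SimpleGraph V) (Y : SimpleGraph W),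
        X.Preconnected → Y.Preconnected → ThinTriangles X (δ₀ : ℝ) →
        ∀ f : V → W, IsLipschitzGraphMap X Y L f →
        ∀ S : Set V,
          (f '' S = Set.univ) →
          (∀ v : V, ∃ s ∈ S, X.dist v s ≤ D) →
          (∀ x ∈ S, ∀ y ∈ S, Y.dist (f x) (f y) ≤ 1 →
            ∀ p : X.Walk x y, IsGeodesicWalk X p →
              SetDiamLE Y (f '' walkSet p) (M : ℝ)) →
          ThinTriangles Y δ₁ ∧
          ∀ x y : V, ∀ p : X.Walk x y, IsGeodesicWalk X p →
            ∀ q : Y.Walk (f x) (f y), IsGeodesicWalk Y q →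
              HausClose Y H (f '' walkSet p) (walkSet q) := by
  set E := L * δ₀ with hE
  set M' := 2 * (L * δ₀) + ((2 * (L * D) + 1) * (L * δ₀) + M) + 3 * (L * D) + 2 with hM'
  obtain ⟨k, hk⟩ := aux_const E M'
  set K := 2 * E + k * E + M' with hK
  refine ⟨((K + E + (3 * K + L) + 1 : ℕ) : ℝ), ((3 * K + L + 1 : ℕ) : ℝ),
    by positivity, by positivity, ?_⟩
  intro V W X Y hX hY hT f hf S hS hD h3
  have tri := aux_tri hY
  have sym : ∀ a b, Y.dist a b = Y.dist b a := fun a b => Y.dist_comm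
  have surj : ∀ w, ∃ s, f s = w := fun w => by
    have : w ∈ f '' S := by rw [hS]; trivial
    obtain ⟨s, _, hs⟩ := this
    exact ⟨s, hs⟩
  have thin := geoImg_thin hX hY hf hT
  have up := aux_upgrade hX hY hf hT S hS hD h3
  have near : ∀ (x y : V) (a b : W) (q : Y.Walk a b), IsGeodesicWalk Y q → f x = a → f y = b →
      ∀ w ∈ geoImg X f x y, ∃ u ∈ q.support, Y.dist w u ≤ K := by
    intro x y a b q hq hx hy w hw
    obtain ⟨m, -, -, h⟩ := aux_near Y.dist tri sym f surj (geoImg X f) E M' k K hK hk thin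
      (fun x y h w hw => ⟨up x y h w hw,
        up y x (by rw [sym]; exact h) w (geoImg_symm _ _ _ _ _ hw)⟩)
      q.getVert (aux_step q) (fun i => by simp) q.length (aux_geo hY q hq) q.length
      0 q.length (by omega) le_rfl (by omega) x y (by simpa using hx) (by simpa using hy) w hw
    exact ⟨q.getVert m, q.getVert_mem_support m, h⟩
  have conv : ∀ (x y : V) (p : X.Walk x y) (a b : W) (q : Y.Walk a b), IsGeodesicWalk X p →
      IsGeodesicWalk Y q → f x = a → f y = b →
      ∀ u ∈ q.support, ∃ v ∈ p.support, Y.dist u (f v) ≤ 3 * K + L := by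
    intro x y p a b q hp hq hx hy u hu
    obtain ⟨j, rfl, hj⟩ := (SimpleGraph.Walk.mem_support_iff_exists_getVert).1 hu
    obtain ⟨i, -, h⟩ := aux_conv Y.dist tri sym K L q.getVert q.length (aux_geo hY q hq)
      (fun i => f (p.getVert i)) p.length
      (fun i => (aux_lip hX hY hf _ _).trans
        ((Nat.mul_le_mul_left L (aux_step p i)).trans (by omega)))
      (by simpa using hx) (by simpa using hy)
      (fun i _ => by
        obtain ⟨u, hu, h⟩ := near x y a b q hq hx hy (f (p.getVert i))
          ⟨p, hp, _, p.getVert_mem_support i, rfl⟩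
        obtain ⟨m, rfl, hm⟩ := (SimpleGraph.Walk.mem_support_iff_exists_getVert).1 hu
        exact ⟨m, hm, h⟩) j hj
    exact ⟨p.getVert i, p.getVert_mem_support i, h⟩
  have side : ∀ (x y z : V) (a b c : W) (p : Y.Walk a b), IsGeodesicWalk Y p → f x = a →
      f y = b → f z = c → ∀ u ∈ p.support, ∃ w, (w ∈ geoImg X f x z ∨ w ∈ geoImg X f z y) ∧
        Y.dist u w ≤ E + (3 * K + L) := by
    intro x y z a b c p hp hx hy hz u hu
    obtain ⟨r, hr⟩ := (hX x y).exists_walk_length_eq_dist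
    obtain ⟨v, hv, h⟩ := conv x y r a b p hr hp hx hy u hu
    obtain ⟨w, hw, h'⟩ := thin x y z (f v) ⟨r, hr, v, hv, rfl⟩
    exact ⟨w, hw, by have := tri u (f v) w; omega⟩
  refine ⟨?_, ?_⟩
  · intro a b c p q r hp hq hr
    obtain ⟨x, hx⟩ := surj a
    obtain ⟨y, hy⟩ := surj b
    obtain ⟨z, hz⟩ := surj c
    have fin : ∀ (x y : V) (a b : W) (q : Y.Walk a b), IsGeodesicWalk Y q → f x = a → f y = b →
        ∀ u w, Y.dist u w ≤ E + (3 * K + L) → (w ∈ geoImg X f x y ∨ w ∈ geoImg X f y x) →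
        ∃ v ∈ walkSet q, (Y.dist u v : ℝ) ≤ ((K + E + (3 * K + L) + 1 : ℕ) : ℝ) := by
      intro x y a b q hq hx hy u w huw hw
      have hw' : w ∈ geoImg X f x y := hw.elim id (geoImg_symm _ _ _ _ _)
      obtain ⟨v, hv, h⟩ := near x y a b q hq hx hy w hw'
      refine ⟨v, hv, ?_⟩
      have := tri u w v
      exact_mod_cast (by omega : Y.dist u v ≤ K + E + (3 * K + L) + 1)
    refine ⟨fun u hu => ?_, fun u hu => ?_, fun u hu => ?_⟩
    · obtain ⟨w, hw, h⟩ := side x y z a b c p hp hx hy hz u hu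
      rcases hw with hw | hw
      · obtain ⟨v, hv, h⟩ := fin x z a c r hr hx hz u w h (Or.inl hw)
        exact ⟨v, Or.inr hv, h⟩
      · obtain ⟨v, hv, h⟩ := fin y z b c q hq hy hz u w h (Or.inr hw)
        exact ⟨v, Or.inl hv, h⟩
    · obtain ⟨w, hw, h⟩ := side y z x b c a q hq hy hz hx u hu
      rcases hw with hw | hw
      · obtain ⟨v, hv, h⟩ := fin x y a b p hp hx hy u w h (Or.inr hw)
        exact ⟨v, Or.inl hv, h⟩
      · obtain ⟨v, hv, h⟩ := fin x z a c r hr hx hz u w h (Or.inl hw)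
        exact ⟨v, Or.inr hv, h⟩
    · obtain ⟨w, hw, h⟩ := side x z y a c b r hr hx hz hy u hu
      rcases hw with hw | hw
      · obtain ⟨v, hv, h⟩ := fin x y a b p hp hx hy u w h (Or.inl hw)
        exact ⟨v, Or.inl hv, h⟩
      · obtain ⟨v, hv, h⟩ := fin y z b c q hq hy hz u w h (Or.inl hw)
        exact ⟨v, Or.inr hv, h⟩
  · intro x y p hp q hq
    refine ⟨?_, ?_⟩
    · rintro _ ⟨v, hv, rfl⟩
      obtain ⟨u, hu, h⟩ := near x y _ _ q hq rfl rfl (f v) ⟨p, hp, v, hv, rfl⟩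
      exact ⟨u, hu, by exact_mod_cast (by omega : Y.dist (f v) u ≤ 3 * K + L + 1)⟩
    · intro u hu
      obtain ⟨v, hv, h⟩ := conv x y p _ _ q hp hq rfl rfl u hu
      exact ⟨f v, ⟨v, hv, rfl⟩, by exact_mod_cast (by omega : Y.dist u (f v) ≤ 3 * K + L + 1)⟩
end

section
/- Let X, Y be connected graphs with their simplicial metrics such that X is δ_0-hyperbolic, let f : X → Y be an L-Lipschitz graph-map, and let S ⊆ V(X) satisfy: f(S) = V(Y); S is D-dense in X; and for all x, y ∈ S with d_Y(f(x), f(y)) ≤ 1 and any geodesic [x,y] in X, diam_Y(f([x,y])) ≤ M. Then for every m_1 > 0 there exists m_2 > 0, depending only on δ_0, L, M, D, m_1 (one may take m_2 = m_1·M + 2·L·m_1·δ_0), such that whenever x, y ∈ S satisfy d_Y(f(x), f(y)) ≤ m_1, then diam_Y(f([x,y])) ≤ m_2 for any geodesic [x,y] in X. -/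
/-!
STATEMENT 10: Let `X`, `Y` be connected graphs with `X` `δ₀`-hyperbolic, `f : X → Y`
an `L`-Lipschitz graph-map, and `S ⊆ V(X)` with `f(S) = V(Y)`, `S` `D`-dense, and
`diam_Y(f([x,y])) ≤ M` whenever `x, y ∈ S` with `d_Y(f x, f y) ≤ 1`. Then for every
`m₁ > 0` there is `m₂ > 0` depending only on `δ₀, L, M, D, m₁` such that whenever
`x, y ∈ S` satisfy `d_Y(f x, f y) ≤ m₁`, then `diam_Y(f([x,y])) ≤ m₂` for any
geodesic `[x,y]` in `X`.
-/

universe u v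

theorem lip_dist_le {V : Type u} {W : Type v} {X : SimpleGraph V} {Y : SimpleGraph W}
    (hY : Y.Preconnected) {L : ℕ} {f : V → W} (hf : IsLipschitzGraphMap X Y L f)
    {a b : V} (p : X.Walk a b) : Y.dist (f a) (f b) ≤ L * p.length := by
  induction p with
  | nil => simp
  | @cons a c b h p ih =>
    have h1 := (hf a c h).2
    have h2 := (hY (f a) (f c)).dist_triangle_left (f b)
    rw [SimpleGraph.Walk.length_cons, Nat.mul_succ]
    omega

theorem exists_near {W : Type v} {Y : SimpleGraph W} {a b : W} {n : ℕ}
    (hn : ¬ Y.dist a b ≤ n) (h : Y.dist a b ≤ n + 1) (hr : Y.Reachable b a) :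
    ∃ u, Y.dist u b ≤ 1 ∧ Y.dist a u ≤ n := by
  obtain ⟨q, hq⟩ := hr.exists_walk_length_eq_dist
  rw [SimpleGraph.dist_comm] at hq
  cases q with
  | nil => simp at hn
  | @cons _ u _ h' q =>
    refine ⟨u, (SimpleGraph.dist_eq_one_iff_adj.2 h'.symm).le, ?_⟩
    have := SimpleGraph.dist_le q
    rw [SimpleGraph.dist_comm] at this
    simp at hq
    omega

theorem geod_bound {V : Type u} {W : Type v} (δ₀ L M : ℕ) {X : SimpleGraph V}
    {Y : SimpleGraph W} (hX : X.Preconnected) (hY : Y.Preconnected)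
    (hδ : ThinTriangles X (δ₀ : ℝ)) {f : V → W} (hf : IsLipschitzGraphMap X Y L f)
    {S : Set V} (hS : f '' S = Set.univ)
    (hM : ∀ x ∈ S, ∀ y ∈ S, Y.dist (f x) (f y) ≤ 1 →
            ∀ p : X.Walk x y, IsGeodesicWalk X p →
              SetDiamLE Y (f '' walkSet p) (M : ℝ)) (n : ℕ) :
    ∀ x ∈ S, ∀ y ∈ S, Y.dist (f x) (f y) ≤ n → ∀ p : X.Walk x y, IsGeodesicWalk X p →
      ∀ w ∈ p.support, Y.dist (f w) (f x) ≤ (n + 1) * (L * δ₀ + M + 1) := by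
  have tri : ∀ a b c : W, Y.dist a c ≤ Y.dist a b + Y.dist b c :=
    fun a b c => (hY a b).dist_triangle_left c
  induction n with
  | zero =>
    intro x hx y hy h p hp w hw
    have := hM x hx y hy (by omega) p hp (f w) ⟨w, hw, rfl⟩ (f x) ⟨x, p.start_mem_support, rfl⟩
    have : Y.dist (f w) (f x) ≤ M := by exact_mod_cast this
    have : 0 ≤ L * δ₀ := Nat.zero_le _
    omega
  | succ n ih =>
    intro x hx y hy h p hp w hw
    have e : (n + 1 + 1) * (L * δ₀ + M + 1)
        = (n + 1) * (L * δ₀ + M + 1) + (L * δ₀ + M + 1) := by ring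
    have e2 : n + 1 ≤ (n + 1) * (L * δ₀ + M + 1) := Nat.le_mul_of_pos_right _ (by omega)
    by_cases hn : Y.dist (f x) (f y) ≤ n
    · have := ih x hx y hy hn p hp w hw
      omega
    obtain ⟨u, hu1, hu2⟩ : ∃ u, Y.dist u (f y) ≤ 1 ∧ Y.dist (f x) u ≤ n :=
      exists_near hn h (hY _ _)
    obtain ⟨z, hz, rfl⟩ : u ∈ f '' S := by rw [hS]; trivial
    obtain ⟨r, hr⟩ := (hX x z).exists_walk_length_eq_dist
    obtain ⟨s, hs⟩ := (hX z y).exists_walk_length_eq_dist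
    obtain ⟨t, ht, hd⟩ := (hδ x z y r s p hr hs hp).2.2 w hw
    have hd : X.dist w t ≤ δ₀ := by exact_mod_cast hd
    obtain ⟨k, hk⟩ := (hX w t).exists_walk_length_eq_dist
    have h1 := lip_dist_le hY hf k
    have h2 : L * k.length ≤ L * δ₀ := Nat.mul_le_mul_left _ (by omega)
    have h3 := tri (f w) (f t) (f x)
    rcases ht with ht | ht
    · have := ih x hx z hz hu2 r hr t ht
      omega
    · have := hM z hz y hy hu1 s hs (f t) ⟨t, ht, rfl⟩ (f z) ⟨z, s.start_mem_support, rfl⟩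
      have : Y.dist (f t) (f z) ≤ M := by exact_mod_cast this
      have h4 := tri (f t) (f z) (f x)
      rw [SimpleGraph.dist_comm (u := f x)] at hu2
      omega

theorem diam_image_of_geodesic_bounded (δ₀ L M D : ℕ) (m₁ : ℝ) (hm₁ : 0 < m₁) :
    ∃ m₂ : ℝ, 0 < m₂ ∧
      ∀ (V : Type u) (W : Type v) (X : SimpleGraph V) (Y : SimpleGraph W),
        X.Preconnected → Y.Preconnected → ThinTriangles X (δ₀ : ℝ) →
        ∀ f : V → W, IsLipschitzGraphMap X Y L f →
        ∀ S : Set V,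
          (f '' S = Set.univ) →
          (∀ v : V, ∃ s ∈ S, X.dist v s ≤ D) →
          (∀ x ∈ S, ∀ y ∈ S, Y.dist (f x) (f y) ≤ 1 →
            ∀ p : X.Walk x y, IsGeodesicWalk X p →
              SetDiamLE Y (f '' walkSet p) (M : ℝ)) →
          ∀ x ∈ S, ∀ y ∈ S, (Y.dist (f x) (f y) : ℝ) ≤ m₁ →
            ∀ p : X.Walk x y, IsGeodesicWalk X p →
              SetDiamLE Y (f '' walkSet p) m₂ := by
  refine ⟨((2 * ((⌈m₁⌉₊ + 1) * (L * δ₀ + M + 1)) : ℕ) : ℝ), by positivity, ?_⟩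
  rintro V W X Y hX hY hδ f hf S hS - hM x hx y hy h p hp _ ⟨a, ha, rfl⟩ _ ⟨b, hb, rfl⟩
  have hn : Y.dist (f x) (f y) ≤ ⌈m₁⌉₊ := by exact_mod_cast h.trans (Nat.le_ceil m₁)
  have h1 := geod_bound δ₀ L M hX hY hδ hf hS hM _ x hx y hy hn p hp a ha
  have h2 := geod_bound δ₀ L M hX hY hδ hf hS hM _ x hx y hy hn p hp b hb
  rw [SimpleGraph.dist_comm] at h2
  have h3 := (hY (f a) (f x)).dist_triangle_left (f b)
  exact_mod_cast (by omega : Y.dist (f a) (f b) ≤ _)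
end
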